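/- Suppose the WSBDF2 convolution kernels are positive semi-definite, i.e., ∑_{k=1}^m w_k ∑_{j=1}^k b_{k−j}^{(k)} w_j ≥ 0 for every m ≤ N and every real sequence w. Then the WSBDF2 solution is unconditionally stable in norm: for every 1 ≤ n ≤ N, ‖u^n‖ ≤ ‖u^0‖ + 2 ∑_{k=1}^n ∑_{j=1}^k d_{k−j}^{(k)} ‖θ f^j + (1 − θ) f^{j−1}‖ ≤ ‖u^0‖ + 2 t_n max_{0 ≤ j ≤ n} ‖f^j‖, where t_n = τ_1 + ⋯ + τ_n. -/

import Mathlib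

open Finset

/-- Adjacent time-step ratios `r_k = τ_k / τ_{k-1}`. -/
noncomputable def rr (τ : ℕ → ℝ) (k : ℕ) : ℝ := τ k / τ (k - 1)

/-- The WSBDF2 convolution kernels `b_j^{(n)}`:
`b_0^{(1)} = 1/τ_1`, and for `n ≥ 2`,
`b_0^{(n)} = (1 + 2θ r_n)/(τ_n (1 + r_n))`, `b_1^{(n)} = (1 - 2θ) r_n² /(τ_n (1 + r_n))`,
all other kernels vanish. -/
noncomputable def bk (θ : ℝ) (τ : ℕ → ℝ) (n j : ℕ) : ℝ :=
  if n = 1 then (if j = 0 then 1 / τ 1 else 0)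
  else if j = 0 then (1 + 2 * θ * rr τ n) / (τ n * (1 + rr τ n))
  else if j = 1 then (1 - 2 * θ) * (rr τ n) ^ 2 / (τ n * (1 + rr τ n))
  else 0

/-- The DOC (discrete orthogonal convolution) kernels: `dk θ τ n m` is `d_m^{(n)}`,
defined by `d_0^{(n)} = 1/b_0^{(n)}` and
`d_{n-k}^{(n)} = -(b_1^{(k+1)}/b_0^{(k)}) d_{n-k-1}^{(n)}` for `1 ≤ k ≤ n-1`. -/
noncomputable def dk (θ : ℝ) (τ : ℕ → ℝ) (n : ℕ) : ℕ → ℝ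
  | 0 => 1 / bk θ τ n 0
  | m + 1 => -(bk θ τ (n - m) 1 / bk θ τ (n - m - 1) 0) * dk θ τ n m

open scoped RealInnerProductSpace

theorem rr_pos {N : ℕ} {τ : ℕ → ℝ} (hτ : ∀ k, 1 ≤ k → k ≤ N → 0 < τ k) {n : ℕ}
    (hn : 2 ≤ n) (hnN : n ≤ N) : 0 < rr τ n :=
  div_pos (hτ n (by omega) hnN) (hτ (n - 1) (by omega) (by omega))

theorem bk_one_one (θ : ℝ) (τ : ℕ → ℝ) : bk θ τ 1 1 = 0 := by simp [bk]

theorem bk_of_two_le (θ : ℝ) (τ : ℕ → ℝ) (n : ℕ) {j : ℕ} (hj : 2 ≤ j) : bk θ τ n j = 0 := by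
  simp [bk, show j ≠ 0 by omega, show j ≠ 1 by omega]

theorem bk_zero_pos {θ : ℝ} (hθ : 0 ≤ θ) {N : ℕ} {τ : ℕ → ℝ}
    (hτ : ∀ k, 1 ≤ k → k ≤ N → 0 < τ k) {n : ℕ} (hn : 1 ≤ n) (hnN : n ≤ N) :
    0 < bk θ τ n 0 := by
  have hτn := hτ n hn hnN
  rcases hn.eq_or_lt with rfl | hn
  · simpa [bk] using hτn
  · have hr := rr_pos hτ hn hnN
    simp only [bk, if_neg hn.ne', if_true]
    positivity

theorem bk_one_nonpos {θ : ℝ} (hθ : 1 / 2 ≤ θ) {N : ℕ} {τ : ℕ → ℝ}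
    (hτ : ∀ k, 1 ≤ k → k ≤ N → 0 < τ k) {n : ℕ} (hn : 1 ≤ n) (hnN : n ≤ N) :
    bk θ τ n 1 ≤ 0 := by
  have hτn := hτ n hn hnN
  rcases hn.eq_or_lt with rfl | hn
  · exact (bk_one_one θ τ).le
  · have hr := rr_pos hτ hn hnN
    simp only [bk, if_neg hn.ne', one_ne_zero, if_false, if_true]
    exact div_nonpos_of_nonpos_of_nonneg
      (mul_nonpos_of_nonpos_of_nonneg (by linarith) (sq_nonneg _)) (by positivity)

/-- The scheme differentiates `t` exactly. -/
theorem bk_mul_step_add {θ : ℝ} {N : ℕ} {τ : ℕ → ℝ}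
    (hτ : ∀ k, 1 ≤ k → k ≤ N → 0 < τ k) {n : ℕ} (hn : 1 ≤ n) (hnN : n ≤ N) :
    bk θ τ n 0 * τ n + bk θ τ n 1 * τ (n - 1) = 1 := by
  have hτn := hτ n hn hnN
  rcases hn.eq_or_lt with rfl | hn
  · simp [bk, hτn.ne']
  · have hτ' := hτ (n - 1) (by omega) (by omega)
    simp only [bk, if_neg hn.ne', one_ne_zero, if_false, if_true, rr]
    field_simp
    ring

theorem sum_bk_mul (θ : ℝ) (τ : ℕ → ℝ) (x : ℕ → ℝ) {k : ℕ} (hk : 1 ≤ k) :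
    ∑ j ∈ Finset.Icc 1 k, bk θ τ k (k - j) * x j =
      bk θ τ k 0 * x k + bk θ τ k 1 * x (k - 1) := by
  rcases hk.eq_or_lt with rfl | hk
  · simp [bk_one_one]
  · obtain ⟨k, rfl⟩ : ∃ l, k = l + 2 := ⟨k - 2, by omega⟩
    rw [Finset.sum_Icc_succ_top (by omega), Finset.sum_Icc_succ_top (by omega),
      Finset.sum_eq_zero fun j hj => ?_]
    · simp only [zero_add, Nat.sub_self, show k + 2 - 1 = k + 1 by omega,
        show k + 2 - (k + 1) = 1 by omega]
      exact add_comm _ _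
    · rw [bk_of_two_le θ τ _ (by have := (Finset.mem_Icc.mp hj).2; omega), zero_mul]

theorem dk_nonneg {θ : ℝ} (hθ : 1 / 2 ≤ θ) {N : ℕ} {τ : ℕ → ℝ}
    (hτ : ∀ k, 1 ≤ k → k ≤ N → 0 < τ k) {n : ℕ} (hnN : n ≤ N) {m : ℕ} (hm : m < n) :
    0 ≤ dk θ τ n m := by
  have hθ' : 0 ≤ θ := by linarith
  induction m with
  | zero => exact (one_div_pos.mpr (bk_zero_pos hθ' hτ hm hnN)).le
  | succ m ih =>
    exact mul_nonneg (neg_nonneg.mpr (div_nonpos_of_nonpos_of_nonneg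
      (bk_one_nonpos hθ hτ (by omega) (by omega))
      (bk_zero_pos hθ' hτ (by omega) (by omega)).le)) (ih (by omega))

/-- The DOC kernels invert the convolution with the WSBDF2 kernels. -/
theorem sum_dk_smul {E : Type*} [AddCommGroup E] [Module ℝ E] {θ : ℝ} (hθ : 0 ≤ θ) {N : ℕ}
    {τ : ℕ → ℝ} (hτ : ∀ k, 1 ≤ k → k ≤ N → 0 < τ k) (x : ℕ → E) {n : ℕ} (hn : 1 ≤ n)
    (hnN : n ≤ N) :
    ∑ j ∈ Finset.Icc 1 n, dk θ τ n (n - j) • (bk θ τ j 0 • x j + bk θ τ j 1 • x (j - 1)) =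
      x n := by
  have hsum : ∀ i, 1 ≤ i → i ≤ n → ∑ j ∈ Finset.Icc 1 i,
      dk θ τ n (n - j) • (bk θ τ j 0 • x j + bk θ τ j 1 • x (j - 1)) =
        (dk θ τ n (n - i) * bk θ τ i 0) • x i := by
    intro i hi
    induction i, hi using Nat.le_induction with
    | base => simp [bk_one_one, mul_smul]
    | succ i hi ih =>
      intro hin
      have hd : dk θ τ n (n - i) * bk θ τ i 0 = -(bk θ τ (i + 1) 1 * dk θ τ n (n - (i + 1))) := by
        have hb := (bk_zero_pos hθ hτ hi (by omega)).ne'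
        rw [show n - i = (n - (i + 1)) + 1 by omega, dk,
          show n - (n - (i + 1)) = i + 1 by omega, Nat.add_sub_cancel]
        field_simp
      rw [Finset.sum_Icc_succ_top (by omega), ih (by omega), hd, Nat.add_sub_cancel]
      module
  rw [hsum n hn le_rfl, Nat.sub_self, dk,
    one_div_mul_cancel (bk_zero_pos hθ hτ hn hnN).ne', one_smul]

theorem sum_dk {θ : ℝ} (hθ : 0 ≤ θ) {N : ℕ} {τ : ℕ → ℝ}
    (hτ : ∀ k, 1 ≤ k → k ≤ N → 0 < τ k) {n : ℕ} (hn : 1 ≤ n) (hnN : n ≤ N) :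
    ∑ j ∈ Finset.Icc 1 n, dk θ τ n (n - j) = τ n := by
  rw [← sum_dk_smul hθ hτ τ hn hnN]
  refine Finset.sum_congr rfl fun j hj => ?_
  rw [Finset.mem_Icc] at hj
  simp only [smul_eq_mul]
  rw [bk_mul_step_add hτ hj.1 (hj.2.trans hnN), mul_one]

section InnerProduct

variable {H : Type*} [NormedAddCommGroup H] [InnerProductSpace ℝ H]

/-- The Gram matrix of a family for the semi-inner product of a positive symmetric operator is
positive semidefinite. -/
theorem posSemidef_inner_apply {ι : Type*} [Fintype ι] (A : H →L[ℝ] H)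
    (hA_selfadj : ∀ x y : H, ⟪A x, y⟫ = ⟪x, A y⟫) (hA_nonneg : ∀ x : H, 0 ≤ ⟪A x, x⟫)
    (w : ι → H) : (Matrix.of fun i j => ⟪A (w i), w j⟫).PosSemidef := by
  refine Matrix.PosSemidef.of_dotProduct_mulVec_nonneg ?_ fun x => ?_
  · ext i j
    change ⟪A (w j), w i⟫ = ⟪A (w i), w j⟫
    rw [hA_selfadj, real_inner_comm]
  · have h := hA_nonneg (∑ i, x i • w i)
    simp only [map_sum, map_smul, sum_inner, inner_sum, inner_smul_left, inner_smul_right,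
      Finset.mul_sum] at h
    rw [Finset.sum_comm] at h
    simpa [dotProduct, Matrix.mulVec, Finset.mul_sum, mul_comm, mul_left_comm] using h

/-- A quadratic form that is nonnegative on real sequences is nonnegative on vector sequences, for
the semi-inner product of a positive symmetric operator. -/
theorem sum_mul_inner_apply_nonneg {ι : Type*} [Fintype ι] (A : H →L[ℝ] H)
    (hA_selfadj : ∀ x y : H, ⟪A x, y⟫ = ⟪x, A y⟫) (hA_nonneg : ∀ x : H, 0 ≤ ⟪A x, x⟫)
    (B : ι → ι → ℝ) (hB : ∀ x : ι → ℝ, 0 ≤ ∑ i, ∑ j, B i j * (x i * x j)) (w : ι → H) :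
    0 ≤ ∑ i, ∑ j, B i j * ⟪A (w i), w j⟫ := by
  obtain ⟨n, C, hC⟩ := Matrix.posSemidef_iff_eq_sum_vecMulVec.mp
    (posSemidef_inner_apply A hA_selfadj hA_nonneg w)
  have hG : ∀ i j, ⟪A (w i), w j⟫ = ∑ l, C l i * C l j := fun i j => by
    simpa [Matrix.sum_apply, Matrix.vecMulVec_apply] using congrFun (congrFun hC i) j
  calc 0 ≤ ∑ l, ∑ i, ∑ j, B i j * (C l i * C l j) := Finset.sum_nonneg fun l _ => hB (C l)
    _ = ∑ i, ∑ j, B i j * ⟪A (w i), w j⟫ := by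
      simp only [hG, Finset.mul_sum]
      rw [Finset.sum_comm]
      exact Finset.sum_congr rfl fun i _ => Finset.sum_comm

theorem sum_inner_apply_bk_nonneg (A : H →L[ℝ] H)
    (hA_selfadj : ∀ x y : H, ⟪A x, y⟫ = ⟪x, A y⟫) (hA_nonneg : ∀ x : H, 0 ≤ ⟪A x, x⟫)
    {θ : ℝ} {τ : ℕ → ℝ} {m : ℕ}
    (hpsd : ∀ w : ℕ → ℝ,
      0 ≤ ∑ k ∈ Finset.Icc 1 m, w k * ∑ j ∈ Finset.Icc 1 k, bk θ τ k (k - j) * w j)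
    (w : ℕ → H) :
    0 ≤ ∑ k ∈ Finset.Icc 1 m, ⟪A (w k), bk θ τ k 0 • w k + bk θ τ k 1 • w (k - 1)⟫ := by
  let b : ℕ → ℕ → ℝ := fun k j =>
    if 1 ≤ k then (if j = k then bk θ τ k 0 else 0) + (if j = k - 1 then bk θ τ k 1 else 0) else 0
  have hb : ∀ g : ℕ → ℕ → ℝ, ∑ k : Fin (m + 1), ∑ j : Fin (m + 1), b k j * g k j =
      ∑ k ∈ Finset.Icc 1 m, (bk θ τ k 0 * g k k + bk θ τ k 1 * g k (k - 1)) := by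
    intro g
    rw [Finset.sum_congr rfl fun (k : Fin (m + 1)) _ =>
      Fin.sum_univ_eq_sum_range (fun j => b k j * g k j) (m + 1)]
    rw [Fin.sum_univ_eq_sum_range fun k => ∑ j ∈ Finset.range (m + 1), b k j * g k j]
    symm
    refine Finset.sum_subset_zero_on_sdiff (fun k hk => ?_) (fun k hk => ?_) (fun k hk => ?_)
    · rw [Finset.mem_Icc] at hk
      rw [Finset.mem_range]
      omega
    · have : ¬ 1 ≤ k := by
        simp only [Finset.mem_sdiff, Finset.mem_range, Finset.mem_Icc] at hk
        omega
      simp [b, this]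
    · rw [Finset.mem_Icc] at hk
      simp only [b, if_pos hk.1, add_mul, ite_mul, zero_mul, Finset.sum_add_distrib,
        Finset.sum_ite_eq', Finset.mem_range]
      rw [if_pos (by omega), if_pos (by omega)]
  have key := sum_mul_inner_apply_nonneg A hA_selfadj hA_nonneg
    (fun i j : Fin (m + 1) => b i j) (fun x => ?_) (fun i => w i)
  · rw [hb fun k j => ⟪A (w k), w j⟫] at key
    simpa only [inner_add_right, inner_smul_right] using key
  · let y : ℕ → ℝ := fun k => if h : k < m + 1 then x ⟨k, h⟩ else 0
    have hy : ∀ i : Fin (m + 1), x i = y i := fun i => by simp only [y, dif_pos i.isLt]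
    simp only [hy]
    rw [hb fun k j => y k * y j]
    refine (hpsd y).trans_eq (Finset.sum_congr rfl fun k hk => ?_)
    rw [sum_bk_mul θ τ y (Finset.mem_Icc.mp hk).1]
    ring

theorem norm_sq_sub_norm_sq_le_inner {θ : ℝ} (hθ : 1 / 2 ≤ θ) (a b : H) :
    ‖a‖ ^ 2 - ‖b‖ ^ 2 ≤ 2 * ⟪a - b, θ • a + (1 - θ) • b⟫ := by
  have h := mul_nonneg (by linarith : 0 ≤ 2 * θ - 1) (sq_nonneg ‖a - b‖)
  rw [norm_sub_sq_real] at h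
  simp only [inner_sub_left, inner_add_right, inner_smul_right, real_inner_self_eq_norm_sq,
    real_inner_comm a b]
  linarith

theorem norm_weighted_le {θ : ℝ} (hθ0 : 0 ≤ θ) (hθ1 : θ ≤ 1) {a b : H} {M : ℝ} (ha : ‖a‖ ≤ M)
    (hb : ‖b‖ ≤ M) : ‖θ • a + (1 - θ) • b‖ ≤ M := by
  have hmem := convex_closedBall (0 : H) M (mem_closedBall_zero_iff.mpr ha)
    (mem_closedBall_zero_iff.mpr hb) hθ0 (sub_nonneg.mpr hθ1) (add_sub_cancel θ 1)
  exact mem_closedBall_zero_iff.mp hmem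

/-- The energy estimate obtained by testing the DOC form of the scheme with
`θ u^k + (1 - θ) u^{k-1}`. -/
theorem norm_sq_le_add_sum_inner_dk (A : H →L[ℝ] H)
    (hA_selfadj : ∀ x y : H, ⟪A x, y⟫ = ⟪x, A y⟫) (hA_nonneg : ∀ x : H, 0 ≤ ⟪A x, x⟫)
    {θ : ℝ} (hθ : 1 / 2 ≤ θ) {m : ℕ} {τ : ℕ → ℝ} (hτ : ∀ k, 1 ≤ k → k ≤ m → 0 < τ k)
    (hpsd : ∀ w : ℕ → ℝ,
      0 ≤ ∑ k ∈ Finset.Icc 1 m, w k * ∑ j ∈ Finset.Icc 1 k, bk θ τ k (k - j) * w j)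
    (u g : ℕ → H)
    (hscheme : ∀ n, 1 ≤ n → n ≤ m →
      bk θ τ n 0 • (u n - u (n - 1)) + bk θ τ n 1 • (u (n - 1) - u (n - 2)) +
        A (θ • u n + (1 - θ) • u (n - 1)) = g n) :
    ‖u m‖ ^ 2 ≤ ‖u 0‖ ^ 2 + 2 * ∑ k ∈ Finset.Icc 1 m,
      ⟪∑ j ∈ Finset.Icc 1 k, dk θ τ k (k - j) • g j, θ • u k + (1 - θ) • u (k - 1)⟫ := by
  have hθ' : 0 ≤ θ := by linarith
  let v : ℕ → H := fun k => θ • u k + (1 - θ) • u (k - 1)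
  let w : ℕ → H := fun k => Nat.rec 0
    (fun i wi => (bk θ τ (i + 1) 0)⁻¹ • (v (i + 1) - bk θ τ (i + 1) 1 • wi)) k
  have hw : ∀ k, 1 ≤ k → k ≤ m → bk θ τ k 0 • w k + bk θ τ k 1 • w (k - 1) = v k := by
    intro k hk hkm
    obtain ⟨i, rfl⟩ : ∃ i, k = i + 1 := ⟨k - 1, by omega⟩
    have hw_succ : w (i + 1) =
      (bk θ τ (i + 1) 0)⁻¹ • (v (i + 1) - bk θ τ (i + 1) 1 • w i) := rfl
    rw [hw_succ, smul_inv_smul₀ (bk_zero_pos hθ' hτ hk hkm).ne', Nat.add_sub_cancel,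
      sub_add_cancel]
  have hdoc : ∀ k, 1 ≤ k → k ≤ m →
      ∑ j ∈ Finset.Icc 1 k, dk θ τ k (k - j) • g j = u k - u (k - 1) + A (w k) := by
    intro k hk hkm
    rw [← sum_dk_smul hθ' hτ (fun k => u k - u (k - 1) + A (w k)) hk hkm]
    refine Finset.sum_congr rfl fun j hj => ?_
    rw [Finset.mem_Icc] at hj
    have hAw := congrArg A (hw j hj.1 (hj.2.trans hkm))
    simp only [map_add, map_smul] at hAw
    rw [← hscheme j hj.1 (hj.2.trans hkm), show A (θ • u j + (1 - θ) • u (j - 1)) = A (v j) from rfl,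
      ← hAw, Nat.sub_sub]
    module
  have hpos : 0 ≤ ∑ k ∈ Finset.Icc 1 m, ⟪A (w k), v k⟫ := by
    refine (sum_inner_apply_bk_nonneg A hA_selfadj hA_nonneg hpsd w).trans_eq
      (Finset.sum_congr rfl fun k hk => ?_)
    rw [Finset.mem_Icc] at hk
    rw [hw k hk.1 hk.2]
  have htel : ∑ k ∈ Finset.Icc 1 m, (‖u k‖ ^ 2 - ‖u (k - 1)‖ ^ 2) = ‖u m‖ ^ 2 - ‖u 0‖ ^ 2 := by
    clear * -
    induction m with
    | zero => simp
    | succ m ih =>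
      rw [Finset.sum_Icc_succ_top (by omega), ih, Nat.add_sub_cancel]
      ring
  have hle : ∑ k ∈ Finset.Icc 1 m, (‖u k‖ ^ 2 - ‖u (k - 1)‖ ^ 2) ≤
      ∑ k ∈ Finset.Icc 1 m, 2 * ⟪u k - u (k - 1), v k⟫ :=
    Finset.sum_le_sum fun k _ => norm_sq_sub_norm_sq_le_inner hθ _ _
  have hsplit : ∑ k ∈ Finset.Icc 1 m, ⟪∑ j ∈ Finset.Icc 1 k, dk θ τ k (k - j) • g j, v k⟫ =
      ∑ k ∈ Finset.Icc 1 m, ⟪u k - u (k - 1), v k⟫ + ∑ k ∈ Finset.Icc 1 m, ⟪A (w k), v k⟫ := by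
    rw [← Finset.sum_add_distrib]
    refine Finset.sum_congr rfl fun k hk => ?_
    rw [Finset.mem_Icc] at hk
    rw [hdoc k hk.1 hk.2, inner_add_left]
  rw [← Finset.mul_sum] at hle
  change _ ≤ _ + 2 * ∑ k ∈ Finset.Icc 1 m, ⟪_, v k⟫
  rw [hsplit]
  linarith

end InnerProduct

/-- if the WSBDF2 convolution kernels are positive semi-definite, then the
WSBDF2 solution is unconditionally stable in the `L²` (Hilbert-space) norm: for `1 ≤ n ≤ N`,
`‖u^n‖ ≤ ‖u^0‖ + 2 ∑_{k=1}^n ∑_{j=1}^k d_{k−j}^{(k)} ‖θ f^j + (1 − θ) f^{j−1}‖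
       ≤ ‖u^0‖ + 2 t_n max_{0 ≤ j ≤ n} ‖f^j‖`, where `t_n = τ_1 + ⋯ + τ_n`. -/
theorem wsbdf2_l2_stability
    {H : Type*} [NormedAddCommGroup H] [InnerProductSpace ℝ H] [CompleteSpace H]
    (A : H →L[ℝ] H)
    (hA_selfadj : ∀ x y : H, ⟪A x, y⟫ = ⟪x, A y⟫)
    (hA_nonneg : ∀ x : H, 0 ≤ ⟪A x, x⟫)
    (θ : ℝ) (hθ : 1 / 2 ≤ θ ∧ θ ≤ 1)
    (N : ℕ) (hN : 1 ≤ N)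
    (τ : ℕ → ℝ) (hτ : ∀ k, 1 ≤ k → k ≤ N → 0 < τ k)
    (hpsd : ∀ m, m ≤ N → ∀ w : ℕ → ℝ,
      0 ≤ ∑ k ∈ Finset.Icc 1 m, w k * ∑ j ∈ Finset.Icc 1 k, bk θ τ k (k - j) * w j)
    (u f : ℕ → H)
    (hscheme1 : (τ 1)⁻¹ • (u 1 - u 0) + A (θ • u 1 + (1 - θ) • u 0)
      = θ • f 1 + (1 - θ) • f 0)
    (hscheme : ∀ n, 2 ≤ n → n ≤ N →
      bk θ τ n 0 • (u n - u (n - 1)) + bk θ τ n 1 • (u (n - 1) - u (n - 2)) +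
        A (θ • u n + (1 - θ) • u (n - 1)) = θ • f n + (1 - θ) • f (n - 1)) :
    ∀ n, 1 ≤ n → n ≤ N →
      ‖u n‖ ≤ ‖u 0‖ + 2 * ∑ k ∈ Finset.Icc 1 n, ∑ j ∈ Finset.Icc 1 k,
          dk θ τ k (k - j) * ‖θ • f j + (1 - θ) • f (j - 1)‖ ∧
      ‖u 0‖ + 2 * ∑ k ∈ Finset.Icc 1 n, ∑ j ∈ Finset.Icc 1 k,
          dk θ τ k (k - j) * ‖θ • f j + (1 - θ) • f (j - 1)‖ ≤
        ‖u 0‖ + 2 * (∑ k ∈ Finset.Icc 1 n, τ k) *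
          (Finset.Icc 0 n).sup' (Finset.nonempty_Icc.mpr (Nat.zero_le n))
            (fun j => ‖f j‖) := by
  intro n hn hnN
  obtain ⟨hθ, hθ1⟩ := hθ
  have hθ0 : 0 ≤ θ := by linarith
  set g : ℕ → H := fun j => θ • f j + (1 - θ) • f (j - 1)
  have hterm : ∀ k ∈ Finset.Icc 1 n, ∀ j ∈ Finset.Icc 1 k, 0 ≤ dk θ τ k (k - j) := by
    intro k hk j hj
    rw [Finset.mem_Icc] at hk hj
    exact dk_nonneg hθ hτ (hk.2.trans hnN) (by omega)
  constructor
  · obtain ⟨m, hm, hmax⟩ := Finset.exists_max_image (Finset.Icc 0 n) (fun k => ‖u k‖)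
      (Finset.nonempty_Icc.mpr (Nat.zero_le n))
    have hmn : m ≤ n := (Finset.mem_Icc.mp hm).2
    have hsub : Finset.Icc 1 m ⊆ Finset.Icc 1 n := Finset.Icc_subset_Icc_right hmn
    have hbound : ∀ k, k ≤ n → ‖u k‖ ≤ ‖u m‖ := fun k hk =>
      hmax k (Finset.mem_Icc.mpr ⟨Nat.zero_le k, hk⟩)
    have henergy := norm_sq_le_add_sum_inner_dk A hA_selfadj hA_nonneg hθ
      (fun k hk hkm => hτ k hk (by omega)) (hpsd m (by omega)) u g (by
        intro k hk hkm
        rcases hk.eq_or_lt with rfl | hk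
        · simpa [bk] using hscheme1
        · exact hscheme k hk (by omega))
    have hinner : ∑ k ∈ Finset.Icc 1 m,
        ⟪∑ j ∈ Finset.Icc 1 k, dk θ τ k (k - j) • g j, θ • u k + (1 - θ) • u (k - 1)⟫ ≤
        (∑ k ∈ Finset.Icc 1 m, ∑ j ∈ Finset.Icc 1 k, dk θ τ k (k - j) * ‖g j‖) * ‖u m‖ := by
      rw [Finset.sum_mul]
      refine Finset.sum_le_sum fun k hk => (real_inner_le_norm _ _).trans ?_
      have hkn := (Finset.mem_Icc.mp (hsub hk)).2
      have hnorm : ‖∑ j ∈ Finset.Icc 1 k, dk θ τ k (k - j) • g j‖ ≤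
          ∑ j ∈ Finset.Icc 1 k, dk θ τ k (k - j) * ‖g j‖ :=
        norm_sum_le_of_le _ fun j hj => by
          rw [norm_smul, Real.norm_of_nonneg (hterm k (hsub hk) j hj)]
      exact mul_le_mul hnorm
        (norm_weighted_le hθ0 hθ1 (hbound k hkn) (hbound (k - 1) (by omega)))
        (norm_nonneg _) ((norm_nonneg _).trans hnorm)
    have hmono : ∑ k ∈ Finset.Icc 1 m, ∑ j ∈ Finset.Icc 1 k, dk θ τ k (k - j) * ‖g j‖ ≤
        ∑ k ∈ Finset.Icc 1 n, ∑ j ∈ Finset.Icc 1 k, dk θ τ k (k - j) * ‖g j‖ :=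
      Finset.sum_le_sum_of_subset_of_nonneg hsub fun k hk _ =>
        Finset.sum_nonneg fun j hj => mul_nonneg (hterm k hk j hj) (norm_nonneg _)
    have hnonneg : 0 ≤ ∑ k ∈ Finset.Icc 1 n, ∑ j ∈ Finset.Icc 1 k, dk θ τ k (k - j) * ‖g j‖ :=
      Finset.sum_nonneg fun k hk =>
        Finset.sum_nonneg fun j hj => mul_nonneg (hterm k hk j hj) (norm_nonneg _)
    refine (hbound n le_rfl).trans ?_
    rcases (norm_nonneg (u m)).eq_or_lt with h0 | h0
    · rw [← h0]
      positivity
    · refine le_of_mul_le_mul_right ?_ h0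
      have h1 := mul_le_mul_of_nonneg_right hmono h0.le
      have h2 := mul_le_mul_of_nonneg_left (hbound 0 (Nat.zero_le n)) (norm_nonneg (u 0))
      nlinarith
  · rw [mul_assoc, Finset.sum_mul]
    gcongr with k hk
    have hkn := Finset.mem_Icc.mp hk
    rw [← sum_dk hθ0 hτ hkn.1 (hkn.2.trans hnN), Finset.sum_mul]
    gcongr with j hj
    · exact hterm k hk j hj
    · have hjk := Finset.mem_Icc.mp hj
      have hf : ∀ i, i ≤ n → ‖f i‖ ≤ (Finset.Icc 0 n).sup'
          (Finset.nonempty_Icc.mpr (Nat.zero_le n)) (fun j => ‖f j‖) := fun i hi =>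
        Finset.le_sup' (fun j => ‖f j‖) (Finset.mem_Icc.mpr ⟨Nat.zero_le i, hi⟩)
      exact norm_weighted_le hθ0 hθ1 (hf j (by omega)) (hf (j - 1) (by omega))
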